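/- arXiv:1709.01891 — 2 statements merged into one kernel-verified Lean document; each statement's English description precedes it below -/
import Mathlib

section
/- Let q be a positive integer and ξ = e^{-iπ/q}. Define η(ξ) = (ξ+1)/(ξ-1). Then the product γ(ξ) = ∏_{j=1}^{q-1} η(ξ^j) equals e^{iπ(q-1)/2}. In particular, γ(ξ) = ±i if q is even and γ(ξ) = ±1 if q is odd. -/
open Complex Finset

lemma xi_prod_pow (c : ℂ) (n : ℕ) :
    ∏ j ∈ Finset.range n, (Complex.exp c) ^ (j + 1) = Complex.exp (c * (n * (n + 1) / 2)) := by
  induction n with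
  | zero => simp
  | succ k ih =>
    rw [Finset.prod_range_succ, ih, ← Complex.exp_nat_mul, ← Complex.exp_add]
    congr 1
    push_cast
    ring

lemma xi_pow_ne_one (q j : ℕ) (hj : 0 < j) (hjq : j < q) :
    (Complex.exp (-(Real.pi * Complex.I) / q)) ^ j ≠ 1 := by
  rw [← Complex.exp_nat_mul, Ne, Complex.exp_eq_one_iff]
  rintro ⟨n, hn⟩
  have hq : (q : ℂ) ≠ 0 := by
    have : q ≠ 0 := by omega
    exact_mod_cast this
  have hpi : (Real.pi : ℂ) * Complex.I ≠ 0 :=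
    mul_ne_zero (by exact_mod_cast Real.pi_ne_zero) Complex.I_ne_zero
  have h1 : (-(j : ℂ)) = n * 2 * q := by
    apply mul_right_cancel₀ hpi
    field_simp at hn
    linear_combination (Real.pi * Complex.I) * hn
  have h2 : (-(j : ℤ)) = n * 2 * q := by exact_mod_cast h1
  rcases lt_or_ge n 0 with h | h
  · nlinarith
  · nlinarith [mul_nonneg h (Int.natCast_nonneg q)]

lemma gamma_xi_I_pow (n : ℕ) (ξ : ℂ)
    (hξ : ξ = Complex.exp (-(Real.pi * Complex.I) / ((n + 1 : ℕ) : ℂ))) :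
    ∏ j ∈ Finset.range n, ((ξ ^ (j + 1) + 1) / (ξ ^ (j + 1) - 1)) = Complex.I ^ n := by
  have hn : ((n : ℂ) + 1) ≠ 0 := by exact_mod_cast Nat.succ_ne_zero n
  have hpow : ξ ^ (n + 1) = -1 := by
    rw [hξ, ← Complex.exp_nat_mul, mul_div_cancel₀ _ (by exact_mod_cast Nat.succ_ne_zero n),
      Complex.exp_neg, Complex.exp_pi_mul_I]
    norm_num
  have hprod : ∏ j ∈ Finset.range n, ξ ^ (j + 1) = (-Complex.I) ^ n := by
    have h : -Complex.I = Complex.exp (-(Real.pi / 2 * Complex.I)) := by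
      rw [Complex.exp_neg, Complex.exp_pi_div_two_mul_I, Complex.inv_I]
    rw [hξ, xi_prod_pow, h, ← Complex.exp_nat_mul]
    congr 1
    push_cast
    field_simp
  have hne : ∏ j ∈ Finset.range n, (ξ ^ (j + 1) - 1) ≠ 0 := by
    rw [Finset.prod_ne_zero_iff]
    intro j hj
    rw [Finset.mem_range] at hj
    rw [sub_ne_zero, hξ]
    exact xi_pow_ne_one _ _ (by omega) (by omega)
  have hrefl := Finset.prod_range_reflect (fun j => ξ ^ (j + 1) - 1) n
  have hnum : ∏ j ∈ Finset.range n, (ξ ^ (j + 1) + 1)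
      = ∏ j ∈ Finset.range n, (-1 * ξ ^ (j + 1) * (ξ ^ (n - 1 - j + 1) - 1)) := by
    apply Finset.prod_congr rfl
    intro j hj
    rw [Finset.mem_range] at hj
    have : ξ ^ (j + 1) * ξ ^ (n - 1 - j + 1) = -1 := by
      rw [← pow_add, ← hpow]
      congr 1
      omega
    linear_combination this
  rw [Finset.prod_div_distrib, div_eq_iff hne, hnum, Finset.prod_mul_distrib, hrefl,
    Finset.prod_mul_distrib, hprod, Finset.prod_const, Finset.card_range, ← mul_pow]
  simp

/-- The product `γ(ξ) = ∏_{j=1}^{q-1} η(ξ^j)` with `ξ = e^{-iπ/q}` and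
`η(z) = (z+1)/(z-1)` equals `e^{iπ(q-1)/2}`; in particular it is `±i` for
`q` even and `±1` for `q` odd. -/
theorem gamma_xi_eval (q : ℕ) (hq : 1 ≤ q)
    (ξ : ℂ) (hξ : ξ = Complex.exp (-(Real.pi * Complex.I) / q))
    (η : ℂ → ℂ) (hη : ∀ z, η z = (z + 1) / (z - 1)) :
    (∏ j ∈ Finset.Icc 1 (q - 1), η (ξ ^ j))
        = Complex.exp (Real.pi * Complex.I * ((q : ℂ) - 1) / 2) ∧
    (Even q → (∏ j ∈ Finset.Icc 1 (q - 1), η (ξ ^ j)) = Complex.I ∨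
              (∏ j ∈ Finset.Icc 1 (q - 1), η (ξ ^ j)) = -Complex.I) ∧
    (Odd q → (∏ j ∈ Finset.Icc 1 (q - 1), η (ξ ^ j)) = 1 ∨
             (∏ j ∈ Finset.Icc 1 (q - 1), η (ξ ^ j)) = -1) := by
  obtain ⟨n, rfl⟩ : ∃ n, q = n + 1 := ⟨q - 1, by omega⟩
  have key : (∏ j ∈ Finset.Icc 1 (n + 1 - 1), η (ξ ^ j)) = Complex.I ^ n := by
    rw [← gamma_xi_I_pow n ξ hξ, Nat.add_sub_cancel, Finset.range_eq_Ico,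
      Finset.prod_Ico_add' (fun j => (ξ ^ j + 1) / (ξ ^ j - 1)) 0 n 1]
    apply Finset.prod_congr
    · ext j
      simp only [Finset.mem_Icc, Finset.mem_Ico]
      omega
    · intro j _
      exact hη _
  rw [key]
  have hI : ∀ m : ℕ, Complex.I ^ (2 * m) = 1 ∨ Complex.I ^ (2 * m) = -1 := by
    intro m
    rw [pow_mul, Complex.I_sq]
    exact neg_one_pow_eq_or ℂ m
  refine ⟨?_, ?_, ?_⟩
  · conv_lhs => rw [← Complex.exp_pi_div_two_mul_I]
    rw [← Complex.exp_nat_mul]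
    congr 1
    push_cast
    ring
  · rintro ⟨m, hm⟩
    obtain ⟨k, rfl⟩ : ∃ k, n = 2 * k + 1 := ⟨m - 1, by omega⟩
    rw [pow_succ]
    rcases hI k with h | h <;> simp [h]
  · rintro ⟨m, hm⟩
    obtain rfl : n = 2 * m := by omega
    exact hI m
end

section
/- For real μ > 1/2, the real part of J(μ) := ∫₀^∞ log(1 + t^{-2μ}) · e^{iπ/(2μ)}/(t² - e^{iπ/μ}) dt equals (π²/4)(1 - μ). -/
open Complex Real

lemma aux_int_log (n : ℕ) :
    MeasureTheory.IntegrableOn (fun t : ℝ => Real.log t * t ^ n) (Set.Ioo 0 1) ∧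
    ∫ t in Set.Ioo (0:ℝ) 1, Real.log t * t ^ n = -(1 / ((n:ℝ) + 1) ^ 2) := by
  have hi : IntervalIntegrable (fun t : ℝ => Real.log t * t ^ n) MeasureTheory.volume 0 1 :=
    (intervalIntegral.intervalIntegrable_log' (a := 0) (b := 1)).mul_continuousOn
      (by fun_prop)
  constructor
  · exact ((intervalIntegrable_iff_integrableOn_Ioo_of_le zero_le_one).1 hi)
  · rw [← MeasureTheory.integral_Ioc_eq_integral_Ioo,
      ← intervalIntegral.integral_of_le zero_le_one]
    have hn : ((n:ℝ) + 1) ≠ 0 := by positivity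
    have h := intervalIntegral.integral_eq_sub_of_hasDerivAt_of_le (a := 0) (b := 1)
      (f := fun t : ℝ => t ^ n * (t * Real.log t) / ((n:ℝ) + 1) - t ^ (n+1) / ((n:ℝ) + 1) ^ 2)
      (f' := fun t : ℝ => Real.log t * t ^ n) zero_le_one
      (by
        have := Real.continuous_mul_log
        exact Continuous.continuousOn (by fun_prop)) (by
        intro t ht
        have ht0 : t ≠ 0 := ht.1.ne'
        have h1 := (((hasDerivAt_pow (n+1) t).mul (Real.hasDerivAt_log ht0)).div_const ((n:ℝ)+1)).sub
          ((hasDerivAt_pow (n+1) t).div_const (((n:ℝ)+1)^2))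
        have e : (fun t : ℝ => t ^ n * (t * Real.log t) / ((n:ℝ) + 1) - t ^ (n+1) / ((n:ℝ) + 1) ^ 2)
          = (fun t : ℝ => (t ^ (n+1) * Real.log t) / ((n:ℝ) + 1) - t ^ (n+1) / ((n:ℝ) + 1) ^ 2) := by
          funext t; ring
        rw [e]
        refine h1.congr_deriv ?_
        push_cast
        field_simp
        ring) hi
    rw [h]; simp

lemma aux_series (a : ℝ) (h0 : 0 ≤ a) (h1 : a ≤ π) :
    HasSum (fun n : ℕ => Real.cos ((2 * n + 1) * a) / (2 * n + 1 : ℝ) ^ 2)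
      (π / 4 * (π / 2 - a)) := by
  have hp := Real.pi_pos
  have A := hasSum_one_div_nat_pow_mul_cos (k := 1) one_ne_zero (x := a / (2 * π))
    ⟨by positivity, by rw [div_le_one (by positivity)]; linarith⟩
  have B := hasSum_one_div_nat_pow_mul_cos (k := 1) one_ne_zero (x := a / π)
    ⟨by positivity, by rw [div_le_one (by positivity)]; linarith⟩
  have hB2 : ∀ x : ℝ, (Polynomial.map (algebraMap ℚ ℝ) (Polynomial.bernoulli 2)).eval x =
      x ^ 2 - x + 1 / 6 := by
    intro x
    simp only [Polynomial.bernoulli, Finset.sum_range_succ, Finset.sum_range_zero,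
      Polynomial.map_add, Polynomial.map_monomial, Polynomial.eval_add, Polynomial.eval_monomial,
      bernoulli_two, bernoulli_one, bernoulli_zero, Nat.choose]
    norm_num
    ring
  simp only [mul_one, hB2] at A B
  set f : ℕ → ℝ := fun n => 1 / (n:ℝ) ^ 2 * Real.cos (2 * π * n * (a / (2 * π))) with hf
  have hE := B.mul_left (1/4)
  have ee : (fun n : ℕ => (1/4 : ℝ) * (1 / (n:ℝ) ^ 2 * Real.cos (2 * π * n * (a / π)))) =
      fun n : ℕ => f (2 * n) := by
    funext n
    have : 2 * π * n * (a / π) = 2 * π * ((2 * n : ℕ) : ℝ) * (a / (2 * π)) := by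
      push_cast; field_simp
    simp only [hf, this]
    push_cast
    rw [mul_pow, one_div, one_div, one_div, mul_inv]; ring
  rw [ee] at hE
  have S : Summable (fun n : ℕ => f (2 * n + 1)) :=
    A.summable.comp_injective (i := fun n : ℕ => 2 * n + 1) (fun x y h => by simpa using h)
  have T := (hE.even_add_odd S.hasSum).unique A
  have h3 : ∑' n : ℕ, f (2 * n + 1) = π / 4 * (π / 2 - a) := by
    rw [eq_sub_of_add_eq' T]
    norm_num [Nat.factorial]
    field_simp
    ring
  have h4 := S.hasSum
  rw [h3] at h4
  have e5 : (fun n : ℕ => f (2 * n + 1)) =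
      fun n : ℕ => Real.cos ((2 * n + 1) * a) / (2 * n + 1 : ℝ) ^ 2 := by
    funext n
    have : 2 * π * ((2 * n + 1 : ℕ) : ℝ) * (a / (2 * π)) = (2 * n + 1) * a := by
      push_cast; field_simp
    simp only [hf, this]
    push_cast
    ring
  rwa [e5] at h4

lemma aux_main (a : ℝ) (h0 : 0 < a) (h1 : a < π) :
    (∫ t in Set.Ioo (0:ℝ) 1, (Real.log t : ℂ) *
      (Complex.exp (a * I) / ((t:ℂ) ^ 2 - Complex.exp (a * I) ^ 2))).re
      = π / 4 * (π / 2 - a) := by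
  set w := Complex.exp (a * I) with hw
  have hwn : ‖w‖ = 1 := Complex.norm_exp_ofReal_mul_I a
  have hw0 : w ≠ 0 := Complex.exp_ne_zero _
  have H := MeasureTheory.hasSum_integral_of_summable_integral_norm
    (μ := MeasureTheory.volume.restrict (Set.Ioo (0:ℝ) 1))
    (F := fun (n : ℕ) (t : ℝ) => ((Real.log t * t ^ (2 * n) : ℝ) : ℂ) * (-(w⁻¹) ^ (2 * n + 1)))
    (fun n => ((aux_int_log (2 * n)).1.ofReal).mul_const _) (by
      have : ∀ n : ℕ, ∫ t in Set.Ioo (0:ℝ) 1,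
          ‖((Real.log t * t ^ (2 * n) : ℝ) : ℂ) * (-(w⁻¹) ^ (2 * n + 1))‖
          = 1 / ((2 * n : ℝ) + 1) ^ 2 := by
        intro n
        have h2 := (aux_int_log (2 * n)).2
        rw [← neg_eq_iff_eq_neg, ← MeasureTheory.integral_neg] at h2
        push_cast at h2
        rw [← h2]
        refine MeasureTheory.setIntegral_congr_fun measurableSet_Ioo ?_
        intro t ht
        have hl : Real.log t ≤ 0 := Real.log_nonpos ht.1.le ht.2.le
        have : 0 ≤ t ^ (2 * n) := pow_nonneg ht.1.le _
        simp only [norm_mul, norm_neg, norm_pow, norm_inv, hwn, Complex.norm_real, Real.norm_eq_abs]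
        rw [abs_of_nonpos hl, abs_of_nonneg ht.1.le]
        simp
      simp only [this]
      have S := (Real.summable_one_div_nat_pow (p := 2)).2 (by norm_num)
      have := S.comp_injective (i := fun n : ℕ => 2 * n + 1) (fun x y h => by simpa using h)
      refine this.congr ?_
      intro n; simp)
  have HI : ∫ t in Set.Ioo (0:ℝ) 1, ∑' n : ℕ,
      ((Real.log t * t ^ (2 * n) : ℝ) : ℂ) * (-(w⁻¹) ^ (2 * n + 1)) =
      ∫ t in Set.Ioo (0:ℝ) 1, (Real.log t : ℂ) * (w / ((t:ℂ) ^ 2 - w ^ 2)) := by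
    refine MeasureTheory.setIntegral_congr_fun measurableSet_Ioo ?_
    intro t ht
    have hr : ‖(t:ℂ) ^ 2 * (w⁻¹) ^ 2‖ < 1 := by
      simp only [norm_mul, norm_pow, norm_inv, hwn, Complex.norm_real, Real.norm_eq_abs]
      rw [abs_of_nonneg ht.1.le]
      have := ht.1; have := ht.2
      norm_num
      rw [abs_of_nonneg ht.1.le]; exact this
    have hne : 1 - (t:ℂ) ^ 2 * (w⁻¹) ^ 2 ≠ 0 := by
      intro h
      have : (t:ℂ) ^ 2 * (w⁻¹) ^ 2 = 1 := (sub_eq_zero.1 h).symm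
      rw [this] at hr; simp at hr
    have g := (hasSum_geometric_of_norm_lt_one hr).mul_left (-(Real.log t : ℂ) * w⁻¹)
    have hne2 : (t:ℂ)^2 - w^2 ≠ 0 := by
      intro h; apply hne; rw [sub_eq_zero.1 h]; field_simp; simp
    have g2 : HasSum (fun n : ℕ => ((Real.log t * t ^ (2 * n) : ℝ) : ℂ) * (-(w⁻¹) ^ (2 * n + 1)))
       ((Real.log t : ℂ) * (w / ((t:ℂ) ^ 2 - w ^ 2))) := by
      have u1 : (fun n : ℕ => ((Real.log t * t ^ (2 * n) : ℝ) : ℂ) * (-(w⁻¹) ^ (2 * n + 1))) =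
          fun i : ℕ => -(Real.log t : ℂ) * w⁻¹ * ((t:ℂ) ^ 2 * w⁻¹ ^ 2) ^ i := by
        funext n; push_cast; ring
      have u2 : (Real.log t : ℂ) * (w / ((t:ℂ) ^ 2 - w ^ 2)) =
          -(Real.log t : ℂ) * w⁻¹ * (1 - (t:ℂ) ^ 2 * w⁻¹ ^ 2)⁻¹ := by
        have : (1 - (t:ℂ) ^ 2 * (w⁻¹) ^ 2) = -((t:ℂ)^2 - w^2) / w^2 := by field_simp; ring
        rw [this]; field_simp
      rw [u1, u2]; exact g
    exact g2.tsum_eq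
  rw [HI] at H
  have HR := Complex.hasSum_re H
  refine HR.unique ?_
  refine (aux_series a h0.le h1.le).congr_fun ?_
  intro n
  have e : ∫ t in Set.Ioo (0:ℝ) 1, ((Real.log t * t ^ (2 * n) : ℝ) : ℂ) * (-(w⁻¹) ^ (2 * n + 1))
     = ((1 / ((2 * n : ℝ) + 1) ^ 2 : ℝ) : ℂ) * (w⁻¹) ^ (2 * n + 1) := by
    rw [MeasureTheory.integral_mul_const, integral_complex_ofReal, (aux_int_log (2 * n)).2]
    push_cast; ring
  rw [e, Complex.re_ofReal_mul, hw, ← Complex.exp_neg, ← Complex.exp_nat_mul]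
  have : ((2 * n + 1 : ℕ) : ℂ) * -(a * I) = ((-((2 * n + 1) * a) : ℝ) : ℂ) * I := by
    push_cast; ring
  rw [this, Complex.exp_ofReal_mul_I_re, Real.cos_neg]; ring

theorem re_J_eval (μ : ℝ) (hμ : 1 / 2 < μ) :
    (∫ t in Set.Ioi (0 : ℝ),
        ((Real.log (1 + t ^ (-(2 * μ))) : ℂ) *
          (Complex.exp (Real.pi * Complex.I / (2 * μ)) /
            ((t : ℂ) ^ 2 - Complex.exp (Real.pi * Complex.I / μ))))).re
      = Real.pi ^ 2 / 4 * (1 - μ) := by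
  have hp := Real.pi_pos
  have hμ0 : 0 < μ := by linarith
  obtain ⟨a, ha⟩ : ∃ a : ℝ, a = π / (2 * μ) := ⟨_, rfl⟩
  have ha0 : 0 < a := by rw [ha]; positivity
  have ha1 : a < π := by rw [ha, div_lt_iff₀ (by positivity)]; nlinarith
  have e1 : Complex.exp (Real.pi * Complex.I / (2 * μ)) = Complex.exp (a * I) := by
    congr 1; rw [ha]; push_cast; ring
  have e2 : Complex.exp (Real.pi * Complex.I / μ) = Complex.exp (a * I) ^ 2 := by
    rw [← Complex.exp_nat_mul]
    congr 1; rw [ha]; push_cast; field_simp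
  rw [e1, e2]
  have M := aux_main a ha0 ha1
  set w := Complex.exp (a * I) with hw
  have hwn : ‖w‖ = 1 := Complex.norm_exp_ofReal_mul_I a
  have hw0 : w ≠ 0 := Complex.exp_ne_zero _
  have hw2 : w ^ 2 ≠ 1 := by
    intro h
    have him : w.im = Real.sin a := Complex.exp_ofReal_mul_I_im a
    have hs := Real.sin_pos_of_pos_of_lt_pi ha0 ha1
    rcases mul_self_eq_one_iff.1 ((sq w).symm.trans h) with h | h <;> · rw [h] at him; simp at him; linarith
  have hd1 : ∀ t ∈ Set.Icc (0:ℝ) 1, (t:ℂ) ^ 2 - w ^ 2 ≠ 0 := by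
    intro t ht h
    have h := sub_eq_zero.1 h
    have hn := congrArg norm h
    simp only [norm_pow, hwn, Complex.norm_real, Real.norm_eq_abs, abs_of_nonneg ht.1] at hn
    have : t = 1 := by nlinarith [ht.1]
    rw [this] at h; apply hw2; rw [← h]; simp
  have hd2 : ∀ t ∈ Set.Icc (0:ℝ) 1, 1 - (t:ℂ) ^ 2 * w ^ 2 ≠ 0 := by
    intro t ht h
    have h := sub_eq_zero.1 h
    have hn := congrArg norm h
    simp only [norm_pow, norm_mul, hwn, Complex.norm_real, Real.norm_eq_abs, abs_of_nonneg ht.1] at hn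
    simp at hn
    have : t = 1 := by nlinarith [ht.1]
    rw [this] at h; apply hw2; rw [h]; simp
  set F : ℝ → ℂ := fun t => (Real.log (1 + t ^ (-(2 * μ))) : ℂ) * (w / ((t : ℂ) ^ 2 - w ^ 2)) with hF
  set G : ℝ → ℂ := fun t => w / ((t : ℂ) ^ 2 - w ^ 2) with hG
  set K : ℝ → ℂ := fun t => w / (1 - (t : ℂ) ^ 2 * w ^ 2) with hK
  set L : ℝ → ℝ := fun t => Real.log (1 + t ^ (2 * μ)) with hL
  have cG : ContinuousOn G (Set.Icc 0 1) :=
    ContinuousOn.div (by fun_prop) (by fun_prop) hd1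
  have cK : ContinuousOn K (Set.Icc 0 1) :=
    ContinuousOn.div (by fun_prop) (by fun_prop) hd2
  have cL : ContinuousOn (fun t => (L t : ℂ)) (Set.Icc 0 1) := by
    refine Complex.continuous_ofReal.comp_continuousOn ?_
    refine ContinuousOn.log ?_ ?_
    · refine continuousOn_const.add ?_
      exact continuousOn_id.rpow_const (fun x _ => Or.inr (by positivity))
    · intro t ht
      have := Real.rpow_nonneg ht.1 (2 * μ)
      positivity
  have iLG : MeasureTheory.IntegrableOn (fun t => (L t : ℂ) * G t) (Set.Ioo 0 1) :=
    ((cL.mul cG).integrableOn_Icc).mono_set Set.Ioo_subset_Icc_self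
  have iLK : MeasureTheory.IntegrableOn (fun t => (L t : ℂ) * K t) (Set.Ioo 0 1) :=
    ((cL.mul cK).integrableOn_Icc).mono_set Set.Ioo_subset_Icc_self
  have ilog : MeasureTheory.IntegrableOn (fun t => (Real.log t : ℂ) * G t) (Set.Ioo 0 1) := by
    have h := (aux_int_log 0).1.ofReal (𝕜 := ℂ)
    have h2 : IntervalIntegrable (fun t : ℝ => (Real.log t : ℂ)) MeasureTheory.volume 0 1 := by
      rw [intervalIntegrable_iff_integrableOn_Ioo_of_le zero_le_one]
      simp only [pow_zero, mul_one] at h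
      exact h
    exact (intervalIntegrable_iff_integrableOn_Ioo_of_le zero_le_one).1
      (h2.mul_continuousOn (by rwa [Set.uIcc_of_le zero_le_one]))
  have eF : Set.EqOn F (fun t => (L t : ℂ) * G t - (2 * μ : ℂ) * ((Real.log t : ℂ) * G t)) (Set.Ioo 0 1) := by
    intro t ht
    have ht0 : 0 < t := ht.1
    have hpw : 0 < t ^ (2 * μ) := Real.rpow_pos_of_pos ht0 _
    have : Real.log (1 + t ^ (-(2 * μ))) = L t - 2 * μ * Real.log t := by
      rw [hL, ← Real.log_rpow ht0, ← Real.log_div (by positivity) (by positivity),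
        Real.rpow_neg ht0.le]
      congr 1; field_simp
      ring
    simp only [hF, this]
    push_cast
    ring
  have iF1 : MeasureTheory.IntegrableOn F (Set.Ioo 0 1) :=
    (MeasureTheory.integrableOn_congr_fun eF measurableSet_Ioo).2 (iLG.sub (ilog.const_mul _))
  have himg : (fun t : ℝ => t⁻¹) '' Set.Ioo 0 1 = Set.Ioi 1 := by
    ext x; constructor
    · rintro ⟨t, ht, rfl⟩
      exact (one_lt_inv₀ ht.1).2 ht.2
    · intro hx
      have hx : 1 < x := hx
      exact ⟨x⁻¹, ⟨by positivity, inv_lt_one_of_one_lt₀ hx⟩, inv_inv x⟩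
  have hder : ∀ t ∈ Set.Ioo (0:ℝ) 1, HasDerivWithinAt (fun t : ℝ => t⁻¹) (-(t^2)⁻¹) (Set.Ioo 0 1) t :=
    fun t ht => (hasDerivAt_inv ht.1.ne').hasDerivWithinAt
  have hinj : Set.InjOn (fun t : ℝ => t⁻¹) (Set.Ioo 0 1) := inv_injective.injOn
  have eF2 : Set.EqOn (fun t : ℝ => |(-(t^2)⁻¹)| • F t⁻¹) (fun t => (L t : ℂ) * K t) (Set.Ioo 0 1) := by
    intro t ht
    have ht0 : 0 < t := ht.1
    have htc : (t:ℂ) ≠ 0 := by exact_mod_cast ht0.ne'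
    have h2 := hd2 t ⟨ht.1.le, ht.2.le⟩
    have e3 : t⁻¹ ^ (-(2 * μ)) = t ^ (2 * μ) := by
      rw [Real.rpow_neg (by positivity), Real.inv_rpow ht0.le, inv_inv]
    have e4 : ((t:ℂ)⁻¹ ^ 2 - w ^ 2) = (1 - (t:ℂ)^2 * w^2) / (t:ℂ)^2 := by field_simp
    simp only [hF, hK, hL, e3, abs_neg, abs_of_pos (show 0 < (t^2)⁻¹ by positivity), Complex.real_smul]
    push_cast
    rw [e4]
    field_simp
  have iF2 : MeasureTheory.IntegrableOn F (Set.Ioi 1) := by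
    rw [← himg, MeasureTheory.integrableOn_image_iff_integrableOn_abs_deriv_smul measurableSet_Ioo hder hinj]
    exact (MeasureTheory.integrableOn_congr_fun eF2 measurableSet_Ioo).2 iLK
  have I2 : ∫ t in Set.Ioi (1:ℝ), F t = ∫ t in Set.Ioo (0:ℝ) 1, (L t : ℂ) * K t := by
    rw [← himg, MeasureTheory.integral_image_eq_integral_abs_deriv_smul measurableSet_Ioo hder hinj]
    exact MeasureTheory.setIntegral_congr_fun measurableSet_Ioo eF2
  have I1 : ∫ t in Set.Ioo (0:ℝ) 1, F t = (∫ t in Set.Ioo (0:ℝ) 1, (L t : ℂ) * G t)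
      - (2 * μ : ℂ) * ∫ t in Set.Ioo (0:ℝ) 1, (Real.log t : ℂ) * G t := by
    rw [MeasureTheory.setIntegral_congr_fun measurableSet_Ioo eF,
      MeasureTheory.integral_sub iLG (ilog.const_mul _), MeasureTheory.integral_const_mul]
  have I0 : ∫ t in Set.Ioi (0:ℝ), F t = (∫ t in Set.Ioo (0:ℝ) 1, F t) + ∫ t in Set.Ioi (1:ℝ), F t := by
    rw [← Set.Ioc_union_Ioi_eq_Ioi (zero_le_one (α := ℝ)),
      MeasureTheory.setIntegral_union (Set.Ioc_disjoint_Ioi le_rfl) measurableSet_Ioi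
        (integrableOn_Ioc_iff_integrableOn_Ioo (by simp) |>.2 iF1) iF2, MeasureTheory.integral_Ioc_eq_integral_Ioo]
  have hcancel : ((∫ t in Set.Ioo (0:ℝ) 1, (L t : ℂ) * G t)
      + ∫ t in Set.Ioo (0:ℝ) 1, (L t : ℂ) * K t).re = 0 := by
    rw [← MeasureTheory.integral_add iLG iLK]
    have hre : ∫ t in Set.Ioo (0:ℝ) 1, ((L t : ℂ) * G t + (L t : ℂ) * K t).re =
        (∫ t in Set.Ioo (0:ℝ) 1, ((L t : ℂ) * G t + (L t : ℂ) * K t)).re :=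
      integral_re (𝕜 := ℂ) (iLG.add iLK)
    rw [← hre]
    rw [MeasureTheory.setIntegral_congr_fun (g := fun _ => (0:ℝ)) measurableSet_Ioo]
    · simp
    intro t ht
    have h1 := hd1 t ⟨ht.1.le, ht.2.le⟩
    have h2 := hd2 t ⟨ht.1.le, ht.2.le⟩
    have hc : (starRingEnd ℂ) w = w⁻¹ := by
      rw [Complex.inv_def, Complex.normSq_eq_norm_sq, hwn]; simp
    have hGK : K t = - (starRingEnd ℂ) (G t) := by
      have h3 : (t:ℂ)^2 - w⁻¹ ^ 2 = - (1 - (t:ℂ) ^ 2 * w ^ 2) / w ^ 2 := by field_simp; ring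
      simp only [hK, hG, map_div₀, map_sub, map_pow, hc, Complex.conj_ofReal, h3]
      field_simp
    simp [hGK]
  change (∫ t in Set.Ioi (0:ℝ), F t).re = _
  rw [I0, I1, I2, show ∀ x y z : ℂ, x - y + z = (x + z) - y by intros; ring, Complex.sub_re, hcancel,
    show (2 * μ : ℂ) = ((2 * μ : ℝ) : ℂ) by push_cast; rfl, Complex.re_ofReal_mul]
  change 0 - 2 * μ * (∫ t in Set.Ioo (0:ℝ) 1, (Real.log t : ℂ) * (w / ((t:ℂ) ^ 2 - w ^ 2))).re = _
  rw [M, ha]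
  field_simp
  ring
end
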